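/- arXiv:1708.04102 — 5 statements merged into one kernel-verified Lean document; each statement's English description precedes it below -/
import Mathlib

section
/- Suppose η : ℕ → F is a Hilbert basis (orthonormal basis) of F consisting of eigenvectors of W = S*S, i.e. W(η_j) = λ_j • η_j, where λ : ℕ → ℝ is nonincreasing (antitone) with λ_j ≥ 0 for all j. Then the operator norm of S equals the square root of the largest eigenvalue: ‖S‖ = √λ₀. -/
open RealInnerProductSpace

/-- Context: `F, G` real Hilbert spaces, `S : F →L[ℝ] G`, `S*` its adjoint, `W = S*S`.
If `b` is a Hilbert (orthonormal) basis of `F` consisting of eigenvectors of `W`,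
`W (b j) = λ j • b j`, with `λ` antitone and nonnegative, then `‖S‖ = √λ₀`. -/
theorem stmt_3 {F G : Type*} [NormedAddCommGroup F] [InnerProductSpace ℝ F] [CompleteSpace F]
    [NormedAddCommGroup G] [InnerProductSpace ℝ G] [CompleteSpace G]
    (S : F →L[ℝ] G) (b : HilbertBasis ℕ ℝ F) (lam : ℕ → ℝ)
    (hanti : Antitone lam) (hlam : ∀ j, 0 ≤ lam j)
    (hW : ∀ j, ContinuousLinearMap.adjoint S (S (b j)) = lam j • b j) :
    ‖S‖ = Real.sqrt (lam 0) := by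
  have hbound (x : F) : ‖S x‖ ^ 2 ≤ lam 0 * ‖x‖ ^ 2 := by
    have h1 : HasSum (fun i => lam i * (⟪x, b i⟫ * ⟪b i, x⟫)) (‖S x‖ ^ 2) := by
      have h := b.hasSum_inner_mul_inner (ContinuousLinearMap.adjoint S (S x)) x
      rw [ContinuousLinearMap.adjoint_inner_left, real_inner_self_eq_norm_sq] at h
      refine (funext fun i => ?_ : _ = fun i => lam i * (⟪x, b i⟫ * ⟪b i, x⟫)) ▸ h
      rw [ContinuousLinearMap.adjoint_inner_left, ← ContinuousLinearMap.adjoint_inner_right, hW,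
        real_inner_smul_right, mul_assoc]
    have h2 := (b.hasSum_inner_mul_inner x x).mul_left (lam 0)
    rw [real_inner_self_eq_norm_sq] at h2
    refine hasSum_le (fun i => mul_le_mul_of_nonneg_right (hanti (Nat.zero_le i)) ?_) h1 h2
    rw [real_inner_comm x (b i)]
    exact mul_self_nonneg _
  have hb : ‖b 0‖ = 1 := b.orthonormal.1 0
  apply le_antisymm
  · refine S.opNorm_le_bound (Real.sqrt_nonneg _) fun x => ?_
    refine (sq_le_sq₀ (norm_nonneg _) (by positivity)).1 ?_
    rw [mul_pow, Real.sq_sqrt (hlam 0)]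
    exact hbound x
  · have h0 : ‖S (b 0)‖ ^ 2 = lam 0 := by
      rw [← real_inner_self_eq_norm_sq, ← ContinuousLinearMap.adjoint_inner_left, hW,
        real_inner_smul_left, real_inner_self_eq_norm_sq, hb, one_pow, mul_one]
    rw [← h0, Real.sqrt_sq (norm_nonneg _)]
    exact S.unit_le_opNorm _ hb.le
end

section
/- Suppose η : ℕ → F is a Hilbert basis (orthonormal basis) of F consisting of eigenvectors of W = S*S, i.e. W(η_j) = λ_j • η_j, where λ : ℕ → ℝ is nonincreasing (antitone) with λ_j ≥ 0 for all j. Define the rank-one continuous linear operator V₁ : F → G by V₁ f = ⟨f, η₀⟩ • S η₀ and set V₂ = S − V₁. Then ‖V₁‖ = √λ₀ and ‖V₂‖ = √λ₁ (the square root of the second largest eigenvalue). -/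
open RealInnerProductSpace

/-- If `b` is a Hilbert basis diagonalizing `T*T` with eigenvalues `μ`, and `μ i` is the largest
eigenvalue, then `‖T‖ = √(μ i)`. -/
theorem HilbertBasis.opNorm_eq_sqrt_of_inner_map {ι F G : Type*}
    [NormedAddCommGroup F] [InnerProductSpace ℝ F] [CompleteSpace F]
    [NormedAddCommGroup G] [InnerProductSpace ℝ G] [CompleteSpace G]
    (b : HilbertBasis ι ℝ F) (T : F →L[ℝ] G) (μ : ι → ℝ)
    (hT : ∀ x j, ⟪T x, T (b j)⟫ = μ j * ⟪x, b j⟫) (i : ι) (hi : ∀ j, μ j ≤ μ i) :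
    ‖T‖ = Real.sqrt (μ i) := by
  have hb : ‖b i‖ = 1 := b.orthonormal.1 i
  have hTi : ‖T (b i)‖ ^ 2 = μ i := by
    rw [← real_inner_self_eq_norm_sq, hT, real_inner_self_eq_norm_sq, hb]
    norm_num
  have hμ : 0 ≤ μ i := hTi ▸ sq_nonneg _
  apply le_antisymm
  · refine T.opNorm_le_bound (Real.sqrt_nonneg _) fun x => ?_
    have h₁ := b.hasSum_inner_mul_inner x (ContinuousLinearMap.adjoint T (T x))
    rw [ContinuousLinearMap.adjoint_inner_right, real_inner_self_eq_norm_sq] at h₁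
    have h₂ := (b.hasSum_inner_mul_inner x x).mul_left (μ i)
    rw [real_inner_self_eq_norm_sq] at h₂
    have h : ‖T x‖ ^ 2 ≤ μ i * ‖x‖ ^ 2 := by
      refine hasSum_le (fun j => ?_) h₁ h₂
      rw [ContinuousLinearMap.adjoint_inner_right, real_inner_comm (T x), hT,
        real_inner_comm x (b j)]
      nlinarith [mul_le_mul_of_nonneg_right (hi j) (mul_self_nonneg ⟪x, b j⟫)]
    rw [← Real.sqrt_sq (norm_nonneg x), ← Real.sqrt_mul hμ]
    exact Real.le_sqrt_of_sq_le h
  · rw [← hTi, Real.sqrt_sq (norm_nonneg _)]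
    simpa [hb] using T.le_opNorm (b i)

/-- Context: `F, G` real Hilbert spaces, `S : F →L[ℝ] G`, `S*` its adjoint, `W = S*S`.
If `b` is a Hilbert (orthonormal) basis of `F` consisting of eigenvectors of `W`,
`W (b j) = λ j • b j`, with `λ` antitone and nonnegative, and `V₁ f = ⟪f, b 0⟫ • S (b 0)`,
`V₂ = S - V₁`, then `‖V₁‖ = √λ₀` and `‖V₂‖ = √λ₁`. -/
theorem stmt_4 {F G : Type*} [NormedAddCommGroup F] [InnerProductSpace ℝ F] [CompleteSpace F]
    [NormedAddCommGroup G] [InnerProductSpace ℝ G] [CompleteSpace G]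
    (S : F →L[ℝ] G) (b : HilbertBasis ℕ ℝ F) (lam : ℕ → ℝ)
    (hanti : Antitone lam) (hlam : ∀ j, 0 ≤ lam j)
    (hW : ∀ j, ContinuousLinearMap.adjoint S (S (b j)) = lam j • b j)
    (V₁ V₂ : F →L[ℝ] G) (hV₁ : ∀ f, V₁ f = ⟪f, b 0⟫ • S (b 0)) (hV₂ : V₂ = S - V₁) :
    ‖V₁‖ = Real.sqrt (lam 0) ∧ ‖V₂‖ = Real.sqrt (lam 1) := by
  have hS : ∀ x j, ⟪S x, S (b j)⟫ = lam j * ⟪x, b j⟫ := fun x j => by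
    rw [← ContinuousLinearMap.adjoint_inner_right, hW, real_inner_smul_right]
  have hb : ∀ j, ⟪b j, b 0⟫ = if j = 0 then 1 else 0 :=
    fun j => orthonormal_iff_ite.1 b.orthonormal j 0
  constructor
  · have h := b.opNorm_eq_sqrt_of_inner_map V₁ (fun j => if j = 0 then lam 0 else 0)
      (fun x j => ?_) 0 (fun j => ?_)
    · simpa using h
    · rw [hV₁, hV₁, hb]
      split_ifs with hj
      · subst hj
        rw [one_smul, real_inner_smul_left, hS, real_inner_self_eq_norm_sq, b.orthonormal.1 0]
        ring
      · simp
    · split_ifs <;> simp_all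
  · have h := b.opNorm_eq_sqrt_of_inner_map V₂ (fun j => if j = 0 then 0 else lam j)
      (fun x j => ?_) 1 (fun j => ?_)
    · simpa using h
    · rw [hV₂, sub_apply, sub_apply, hV₁, hV₁, hb]
      split_ifs with hj
      · subst hj
        simp
      · rw [zero_smul, sub_zero, inner_sub_left, real_inner_smul_left, hS, hS,
          real_inner_comm (b j) (b 0), hb, if_neg hj]
        ring
    · split_ifs with hj
      · simp_all
      · simp_all
      · simp_all
      · exact hanti (Nat.one_le_iff_ne_zero.2 hj)
end

section
/- Let η₁ ∈ F with ‖η₁‖ = 1 and t* ∈ D with η₁(t*) ≠ 0, let f̃ := η₁ − η₁(t*)⁻¹ • (K t*), assume f̃ ≠ 0, and define K̃ x := K x − (f̃(x)/‖f̃‖²) • f̃ for x ∈ D. Then ⟨η₁, f̃⟩ = 0 (so η₁ lies in the hyperplane orthogonal to f̃), K̃ t* = η₁(t*) • η₁, and ‖K̃ t*‖² = η₁(t*)²; consequently η₁ = δ · ‖K̃ t*‖⁻¹ • (K̃ t*) where δ is the sign of η₁(t*), i.e. in the modified space the eigenfunction η₁ is a multiple of the kernel function K̃(·, t*). -/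
open RealInnerProductSpace

/-- Context: `D` a nonempty set, `F` a real Hilbert space, `K : D → F` a reproducing
family; `f(t) := ⟪f, K t⟫`. Let `‖η₁‖ = 1`, `η₁(t*) ≠ 0`,
`f̃ = η₁ − η₁(t*)⁻¹ • K t* ≠ 0`, and `K̃ x = K x − (f̃(x)/‖f̃‖²) • f̃`. Then
`⟪η₁, f̃⟫ = 0`, `K̃ t* = η₁(t*) • η₁`, `‖K̃ t*‖² = η₁(t*)²`, and
`η₁ = sign(η₁(t*)) · ‖K̃ t*‖⁻¹ • K̃ t*`. -/
theorem stmt_9 {D : Type*} [Nonempty D] {F : Type*}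
    [NormedAddCommGroup F] [InnerProductSpace ℝ F] [CompleteSpace F]
    (K : D → F) (η₁ : F) (hnorm : ‖η₁‖ = 1) (tstar : D) (h : ⟪η₁, K tstar⟫ ≠ 0)
    (ftilde : F) (hf : ftilde = η₁ - (⟪η₁, K tstar⟫)⁻¹ • K tstar) (hne : ftilde ≠ 0)
    (Ktilde : D → F)
    (hKt : ∀ x, Ktilde x = K x - (⟪ftilde, K x⟫ / ‖ftilde‖ ^ 2) • ftilde) :
    ⟪η₁, ftilde⟫ = 0 ∧
    Ktilde tstar = ⟪η₁, K tstar⟫ • η₁ ∧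
    ‖Ktilde tstar‖ ^ 2 = ⟪η₁, K tstar⟫ ^ 2 ∧
    η₁ = (Real.sign ⟪η₁, K tstar⟫ * ‖Ktilde tstar‖⁻¹) • Ktilde tstar := by
  have horth : ⟪η₁, ftilde⟫ = 0 := by
    rw [hf, inner_sub_right, real_inner_smul_right, real_inner_self_eq_norm_sq, hnorm,
      inv_mul_cancel₀ h]
    norm_num
  have hK : K tstar = ⟪η₁, K tstar⟫ • (η₁ - ftilde) := by
    rw [hf, sub_sub_cancel, smul_inv_smul₀ h]
  have hn : ‖ftilde‖ ^ 2 ≠ 0 := pow_ne_zero 2 (norm_ne_zero_iff.mpr hne)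
  have hin : ⟪ftilde, K tstar⟫ = -⟪η₁, K tstar⟫ * ‖ftilde‖ ^ 2 := by
    conv_lhs => rw [hK]
    rw [real_inner_smul_right, inner_sub_right, real_inner_comm η₁ ftilde, horth,
      real_inner_self_eq_norm_sq]
    ring
  have hKtilde : Ktilde tstar = ⟪η₁, K tstar⟫ • η₁ := by
    rw [hKt, hin, mul_div_cancel_right₀ _ hn]
    nth_rewrite 1 [hK]
    module
  have hKnorm : ‖Ktilde tstar‖ = |⟪η₁, K tstar⟫| := by
    rw [hKtilde, norm_smul, hnorm, mul_one, Real.norm_eq_abs]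
  refine ⟨horth, hKtilde, by rw [hKnorm, sq_abs], ?_⟩
  rw [hKnorm, hKtilde, smul_smul]
  have hsign : Real.sign ⟪η₁, K tstar⟫ * |⟪η₁, K tstar⟫|⁻¹ * ⟪η₁, K tstar⟫ = 1 := by
    rcases lt_or_gt_of_ne h with hneg | hpos
    · rw [Real.sign_of_neg hneg, abs_of_neg hneg]
      field_simp
    · rw [Real.sign_of_pos hpos, abs_of_pos hpos]
      field_simp
  rw [hsign, one_smul]
end

section
/- Let α > 0, r > 0 and λ ∈ (0,1) be real numbers. Then there exist constants C ≥ 0 and t ≥ 0 such that for every integer d ≥ 1 and every real ε ∈ (0,1) there exists an integer n ≥ 1 satisfying both: (i) α · n^{−r} · Σ_{ℓ=0}^{m} C(d,ℓ) ≤ ε/2, and (ii) n · Σ_{ℓ=0}^{m} C(d,ℓ) ≤ C · exp( t · (1 + ln ε⁻¹) · (1 + ln d) ), where m = min(d, ⌈2·ln(2/ε)/ln(1/λ)⌉). (This is the quantitative cardinality-versus-error estimate establishing quasi-polynomial tractability of the algorithm A_{d,n,ε}.) -/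
theorem sum_range_choose_le_succ_pow (d k M : ℕ) (hk : k ≤ M) :
    ∑ ℓ ∈ Finset.range (k + 1), (d.choose ℓ : ℝ) ≤ ((d : ℝ) + 1) ^ M := by
  calc ∑ ℓ ∈ Finset.range (k + 1), (d.choose ℓ : ℝ)
      ≤ ∑ ℓ ∈ Finset.range (k + 1), (d : ℝ) ^ ℓ * (k.choose ℓ : ℝ) := by
        refine Finset.sum_le_sum fun ℓ hℓ => ?_
        have hpos : 1 ≤ k.choose ℓ := Nat.choose_pos (Nat.lt_succ_iff.mp (Finset.mem_range.mp hℓ))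
        exact_mod_cast (Nat.choose_le_pow d ℓ).trans (Nat.le_mul_of_pos_right _ hpos)
    _ = ((d : ℝ) + 1) ^ k := by simp [add_pow]
    _ ≤ ((d : ℝ) + 1) ^ M := pow_le_pow_right₀ (by simp) hk

theorem one_le_sum_range_choose (d k : ℕ) :
    1 ≤ ∑ ℓ ∈ Finset.range (k + 1), (d.choose ℓ : ℝ) := by
  simpa using Finset.single_le_sum (f := fun ℓ => (d.choose ℓ : ℝ))
    (fun ℓ _ => Nat.cast_nonneg _) (Finset.mem_range.mpr k.succ_pos)

theorem sum_range_choose_le_exp {L : ℝ} (hL : 0 < L) {d : ℕ} (hd : 1 ≤ d) {ε : ℝ}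
    (hε : 0 < ε) (hε1 : ε < 1) :
    ∑ ℓ ∈ Finset.range (min d ⌈2 * Real.log (2 / ε) / L⌉₊ + 1), (d.choose ℓ : ℝ) ≤
      Real.exp ((1 + 2 / L) * ((1 + Real.log ε⁻¹) * (1 + Real.log d))) := by
  have hd' : (1 : ℝ) ≤ d := by exact_mod_cast hd
  have hlogd : 0 ≤ Real.log d := Real.log_nonneg hd'
  have hlogε : 0 ≤ Real.log ε⁻¹ := Real.log_nonneg ((one_le_inv₀ hε).mpr hε1.le)
  have hlog2 : Real.log 2 ≤ 1 := by linarith [Real.log_two_lt_d9]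
  have hlog2ε : Real.log (2 / ε) = Real.log 2 + Real.log ε⁻¹ := by
    rw [div_eq_mul_inv, Real.log_mul two_ne_zero (inv_ne_zero hε.ne')]
  have hlog2ε_nonneg : 0 ≤ Real.log (2 / ε) := by
    rw [hlog2ε]; positivity
  have hM : (⌈2 * Real.log (2 / ε) / L⌉₊ : ℝ) ≤ (1 + 2 / L) * (1 + Real.log ε⁻¹) := by
    calc (⌈2 * Real.log (2 / ε) / L⌉₊ : ℝ) ≤ 2 * Real.log (2 / ε) / L + 1 :=
          (Nat.ceil_lt_add_one (by positivity)).le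
      _ ≤ 2 * (1 + Real.log ε⁻¹) / L + (1 + Real.log ε⁻¹) := by
          gcongr <;> linarith
      _ = (1 + 2 / L) * (1 + Real.log ε⁻¹) := by ring
  have hlogd1 : Real.log ((d : ℝ) + 1) ≤ 1 + Real.log d := by
    calc Real.log ((d : ℝ) + 1) ≤ Real.log (2 * d) := Real.log_le_log (by positivity) (by linarith)
      _ = Real.log 2 + Real.log d := Real.log_mul two_ne_zero (by positivity)
      _ ≤ 1 + Real.log d := by linarith
  calc _ ≤ ((d : ℝ) + 1) ^ ⌈2 * Real.log (2 / ε) / L⌉₊ :=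
        sum_range_choose_le_succ_pow _ _ _ (min_le_right _ _)
    _ = Real.exp (⌈2 * Real.log (2 / ε) / L⌉₊ * Real.log ((d : ℝ) + 1)) := by
        rw [Real.exp_nat_mul, Real.exp_log (by positivity)]
    _ ≤ Real.exp ((1 + 2 / L) * (1 + Real.log ε⁻¹) * (1 + Real.log d)) := by
        gcongr
        exact Real.log_nonneg (by linarith)
    _ = _ := by rw [mul_assoc]

theorem exists_nat_mul_rpow_neg_le {α r ε S k X : ℝ} (hα : 0 < α) (hr : 0 < r) (hε : 0 < ε)
    (hS : 1 ≤ S) (hk : 0 ≤ k) (hX : 0 ≤ X) (hSX : S ≤ Real.exp (k * X))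
    (hεX : ε⁻¹ ≤ Real.exp X) :
    ∃ n : ℕ, 1 ≤ n ∧ α * (n : ℝ) ^ (-r) * S ≤ ε / 2 ∧
      (n : ℝ) * S ≤ ((2 * α) ^ (1 / r) + 1) * Real.exp (((k + 1) / r + k) * X) := by
  have hS0 : 0 < S := one_pos.trans_le hS
  set B : ℝ := 2 * α * S * ε⁻¹ with hB
  have hB0 : 0 < B := by positivity
  have hBr : 0 < B ^ (1 / r) := Real.rpow_pos_of_pos hB0 _
  have hn : B ^ (1 / r) ≤ (⌈B ^ (1 / r)⌉₊ : ℝ) := Nat.le_ceil _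
  refine ⟨⌈B ^ (1 / r)⌉₊, Nat.ceil_pos.mpr hBr, ?_, ?_⟩
  · have hpow : (⌈B ^ (1 / r)⌉₊ : ℝ) ^ (-r) ≤ B⁻¹ := by
      calc (⌈B ^ (1 / r)⌉₊ : ℝ) ^ (-r) ≤ (B ^ (1 / r)) ^ (-r) :=
            Real.rpow_le_rpow_of_nonpos hBr hn (by linarith)
        _ = B⁻¹ := by
            rw [← Real.rpow_mul hB0.le, ← Real.rpow_neg_one]
            congr 1
            field_simp
    calc α * (⌈B ^ (1 / r)⌉₊ : ℝ) ^ (-r) * S ≤ α * B⁻¹ * S := by gcongr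
      _ = ε / 2 := by rw [hB]; field_simp
  · have hBX : B ^ (1 / r) ≤ (2 * α) ^ (1 / r) * Real.exp ((k + 1) / r * X) := by
      calc B ^ (1 / r) ≤ (2 * α * Real.exp ((k + 1) * X)) ^ (1 / r) := by
            refine Real.rpow_le_rpow hB0.le ?_ (by positivity)
            calc B = 2 * α * (S * ε⁻¹) := by rw [hB]; ring
              _ ≤ 2 * α * (Real.exp (k * X) * Real.exp X) := by gcongr
              _ = 2 * α * Real.exp ((k + 1) * X) := by rw [← Real.exp_add]; ring_nf
        _ = (2 * α) ^ (1 / r) * Real.exp ((k + 1) / r * X) := by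
            rw [Real.mul_rpow (by positivity) (Real.exp_pos _).le, ← Real.exp_mul]
            congr 2
            ring
    have hexp : 1 ≤ Real.exp ((k + 1) / r * X) := Real.one_le_exp (by positivity)
    calc (⌈B ^ (1 / r)⌉₊ : ℝ) * S ≤ (B ^ (1 / r) + 1) * S := by
          gcongr
          exact (Nat.ceil_lt_add_one hBr.le).le
      _ ≤ ((2 * α) ^ (1 / r) * Real.exp ((k + 1) / r * X) + Real.exp ((k + 1) / r * X)) *
            Real.exp (k * X) := by
          gcongr
      _ = ((2 * α) ^ (1 / r) + 1) * Real.exp (((k + 1) / r + k) * X) := by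
          rw [add_mul _ k X, Real.exp_add]
          ring

/-- Let `α > 0`, `r > 0`, `λ ∈ (0,1)`. Then there exist `C ≥ 0` and `t ≥ 0` such that
for every integer `d ≥ 1` and real `ε ∈ (0,1)` there is an integer `n ≥ 1` with
(i) `α·n^(−r)·Σ_{ℓ=0}^{m} C(d,ℓ) ≤ ε/2` and
(ii) `n·Σ_{ℓ=0}^{m} C(d,ℓ) ≤ C·exp(t·(1 + ln ε⁻¹)·(1 + ln d))`,
where `m = min(d, ⌈2·ln(2/ε)/ln(1/λ)⌉)`. -/
theorem stmt_13 (α r lam : ℝ) (hα : 0 < α) (hr : 0 < r) (h1 : 0 < lam) (h2 : lam < 1) :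
    ∃ C ≥ (0 : ℝ), ∃ t ≥ (0 : ℝ), ∀ d : ℕ, 1 ≤ d → ∀ ε : ℝ, 0 < ε → ε < 1 →
      ∃ n : ℕ, 1 ≤ n ∧
        α * (n : ℝ) ^ (-r) *
            (∑ ℓ ∈ Finset.range
              (min d ⌈2 * Real.log (2 / ε) / Real.log (1 / lam)⌉₊ + 1),
              (d.choose ℓ : ℝ)) ≤ ε / 2 ∧
        (n : ℝ) *
            (∑ ℓ ∈ Finset.range
              (min d ⌈2 * Real.log (2 / ε) / Real.log (1 / lam)⌉₊ + 1),
              (d.choose ℓ : ℝ)) ≤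
          C * Real.exp (t * (1 + Real.log ε⁻¹) * (1 + Real.log d)) := by
  have hL : 0 < Real.log (1 / lam) := Real.log_pos (by rwa [lt_div_iff₀ h1, one_mul])
  refine ⟨(2 * α) ^ (1 / r) + 1, by positivity,
    (1 + 2 / Real.log (1 / lam) + 1) / r + (1 + 2 / Real.log (1 / lam)), by positivity,
    fun d hd ε hε hε1 => ?_⟩
  have hlogd : 0 ≤ Real.log d := Real.log_nonneg (by exact_mod_cast hd)
  have hlogε : 0 ≤ Real.log ε⁻¹ := Real.log_nonneg ((one_le_inv₀ hε).mpr hε1.le)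
  have hεX : ε⁻¹ ≤ Real.exp ((1 + Real.log ε⁻¹) * (1 + Real.log d)) := by
    rw [← Real.log_le_iff_le_exp (inv_pos.mpr hε)]
    nlinarith [mul_nonneg hlogε hlogd]
  simp only [mul_assoc _ (1 + Real.log ε⁻¹)]
  exact exists_nat_mul_rpow_neg_le hα hr hε (one_le_sum_range_choose _ _) (by positivity)
    (by positivity) (sum_range_choose_le_exp hL hd hε hε1) hεX
end

section
/- Let G be a real Hilbert space and S : F → G a compact continuous linear operator. Assume that every continuous linear functional on F can be approximated arbitrarily well in norm by sampling algorithms: for every continuous linear functional L : F → ℝ and every δ > 0 there exist n ∈ ℕ, points t₁, …, tₙ ∈ D and reals a₁, …, aₙ such that the continuous linear functional f ↦ Σ_{i=1}^n a_i · f(t_i) differs from L by at most δ in operator norm. Then for every δ > 0 there exist n ∈ ℕ, points t₁, …, tₙ ∈ D and vectors g₁, …, gₙ ∈ G such that the continuous linear operator f ↦ Σ_{i=1}^n f(t_i) • g_i differs from S by at most δ in operator norm. In other words, the minimal worst case errors e_n(S) of algorithms using n function values converge to 0 as n → ∞. -/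
open RealInnerProductSpace

/-- The operators `f ↦ ∑ i, ⟪f, K (t i)⟫ • g i`: finite sums of rank-one sampling operators. -/
noncomputable def samplingOperators {D F : Type*} (G : Type*)
    [NormedAddCommGroup F] [InnerProductSpace ℝ F]
    [NormedAddCommGroup G] [InnerProductSpace ℝ G] (K : D → F) : Submodule ℝ (F →L[ℝ] G) :=
  Submodule.span ℝ (Set.range fun p : D × G => (innerSL ℝ (K p.1)).smulRight p.2)

section

variable {D F G : Type*}
  [NormedAddCommGroup F] [InnerProductSpace ℝ F]
  [NormedAddCommGroup G] [InnerProductSpace ℝ G]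

theorem exists_eq_sum_of_mem_samplingOperators {K : D → F} {A : F →L[ℝ] G}
    (hA : A ∈ samplingOperators G K) :
    ∃ (n : ℕ) (t : Fin n → D) (g : Fin n → G), ∀ f, A f = ∑ i, ⟪f, K (t i)⟫ • g i := by
  obtain ⟨n, c, B, rfl⟩ := Submodule.mem_span_set'.1 hA
  choose p hp using fun i => (B i).2
  refine ⟨n, fun i => (p i).1, fun i => c i • (p i).2, fun f => ?_⟩
  simp [← hp, real_inner_comm, smul_comm (c _)]

theorem smulRight_mem_closure_samplingOperators {K : D → F} {L : F →L[ℝ] ℝ}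
    (hL : ∀ δ : ℝ, 0 < δ →
      ∃ (n : ℕ) (t : Fin n → D) (a : Fin n → ℝ) (T : F →L[ℝ] ℝ),
        (∀ f, T f = ∑ i, a i * ⟪f, K (t i)⟫) ∧ ‖L - T‖ ≤ δ) (g : G) :
    L.smulRight g ∈ (samplingOperators G K).topologicalClosure := by
  refine Metric.mem_closure_iff.2 fun ε hε => ?_
  obtain ⟨n, t, a, T, hT, hLT⟩ := hL (ε / (‖g‖ + 1)) (by positivity)
  have hsum : T.smulRight g = ∑ i, a i • (innerSL ℝ (K (t i))).smulRight g := by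
    ext f
    simp [hT, Finset.sum_smul, mul_smul, real_inner_comm]
  refine ⟨T.smulRight g, ?_, ?_⟩
  · rw [hsum]
    exact Submodule.sum_mem _ fun i _ =>
      Submodule.smul_mem _ _ (Submodule.subset_span ⟨(t i, g), rfl⟩)
  · have hsub : L.smulRight g - T.smulRight g = (L - T).smulRight g := by
      ext f
      simp [sub_smul]
    rw [dist_eq_norm, hsub, ContinuousLinearMap.norm_smulRight_apply]
    calc ‖L - T‖ * ‖g‖ ≤ ε / (‖g‖ + 1) * ‖g‖ := by gcongr
      _ < ε / (‖g‖ + 1) * (‖g‖ + 1) := by gcongr; linarith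
      _ = ε := by field_simp

/-- A compact operator into a Hilbert space is approximated in norm by its compositions with
orthogonal projections onto finite-dimensional subspaces. -/
theorem IsCompactOperator.exists_norm_sub_starProjection_comp_le {S : F →L[ℝ] G}
    (hS : IsCompactOperator S) {δ : ℝ} (hδ : 0 < δ) :
    ∃ (V : Submodule ℝ G) (_ : FiniteDimensional ℝ V), ‖S - V.starProjection ∘L S‖ ≤ δ := by
  obtain ⟨s, -, hs, hcover⟩ := exists_finite_cover_balls_of_isCompact_closure
    (IsCompactOperator.isCompact_closure_image_closedBall (f := (S : F →ₗ[ℝ] G)) hS 1) hδ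
  have hfin : FiniteDimensional ℝ (Submodule.span ℝ s) := .span_of_finite ℝ hs
  refine ⟨Submodule.span ℝ s, hfin, ?_⟩
  refine ContinuousLinearMap.opNorm_le_of_unit_norm hδ.le fun f hf => ?_
  obtain ⟨y, hy, hfy⟩ := Set.mem_iUnion₂.1
    (hcover (Set.mem_image_of_mem _ (mem_closedBall_zero_iff.2 hf.le)))
  calc ‖S f - (Submodule.span ℝ s).starProjection (S f)‖ ≤ ‖S f - y‖ := by
        rw [Submodule.starProjection_minimal]
        exact ciInf_le ⟨0, by rintro _ ⟨z, rfl⟩; positivity⟩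
          (⟨y, Submodule.subset_span hy⟩ : Submodule.span ℝ s)
    _ ≤ δ := (mem_ball_iff_norm.1 hfy).le

theorem starProjection_comp_eq_sum_smulRight (V : Submodule ℝ G) [FiniteDimensional ℝ V]
    (S : F →L[ℝ] G) :
    V.starProjection ∘L S = ∑ i, (innerSL ℝ (stdOrthonormalBasis ℝ V i : G) ∘L S).smulRight
      (stdOrthonormalBasis ℝ V i : G) := by
  ext f
  simp [Submodule.starProjection_apply,
    (stdOrthonormalBasis ℝ V).orthogonalProjectionOnto_apply_eq_sum]

end


/-- Context: `D` a nonempty set, `F` a real Hilbert space, `K : D → F` a reproducing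
family; `f(t) := ⟪f, K t⟫` is a continuous linear functional on `F`. Let `G` be a real
Hilbert space and `S : F →L[ℝ] G` a compact operator. Assume every continuous linear
functional `L` on `F` can be approximated to within any `δ > 0` in operator norm by a
sampling functional `f ↦ Σ_i a_i · f(t_i)`. Then for every `δ > 0` the operator `S`
can be approximated to within `δ` in operator norm by a sampling algorithm
`f ↦ Σ_i f(t_i) • g_i` with `g_i ∈ G`; i.e. the minimal worst case errors of
algorithms using `n` function values tend to `0`. -/
theorem stmt_14 {D : Type*} [Nonempty D] {F G : Type*}
    [NormedAddCommGroup F] [InnerProductSpace ℝ F] [CompleteSpace F]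
    [NormedAddCommGroup G] [InnerProductSpace ℝ G] [CompleteSpace G]
    (K : D → F) (S : F →L[ℝ] G) (hS : IsCompactOperator S)
    (happrox : ∀ L : F →L[ℝ] ℝ, ∀ δ : ℝ, 0 < δ →
      ∃ (n : ℕ) (t : Fin n → D) (a : Fin n → ℝ) (T : F →L[ℝ] ℝ),
        (∀ f, T f = ∑ i, a i * ⟪f, K (t i)⟫) ∧ ‖L - T‖ ≤ δ) :
    ∀ δ : ℝ, 0 < δ →
      ∃ (n : ℕ) (t : Fin n → D) (g : Fin n → G) (A : F →L[ℝ] G),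
        (∀ f, A f = ∑ i, ⟪f, K (t i)⟫ • g i) ∧ ‖S - A‖ ≤ δ := by
  intro δ hδ
  obtain ⟨V, _, hV⟩ := hS.exists_norm_sub_starProjection_comp_le (half_pos hδ)
  have hmem : V.starProjection ∘L S ∈ (samplingOperators G K).topologicalClosure := by
    rw [starProjection_comp_eq_sum_smulRight]
    exact Submodule.sum_mem _ fun i _ => smulRight_mem_closure_samplingOperators (happrox _) _
  obtain ⟨A, hA, hVA⟩ := Metric.mem_closure_iff.1 hmem (δ / 2) (half_pos hδ)
  obtain ⟨n, t, g, hsum⟩ := exists_eq_sum_of_mem_samplingOperators hA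
  refine ⟨n, t, g, A, hsum, ?_⟩
  rw [dist_eq_norm] at hVA
  linarith [norm_sub_le_norm_sub_add_norm_sub S (V.starProjection ∘L S) A]
end
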